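/- Let A be a 2×2 integer matrix with determinant 1 and trace > 2, and let 𝒳, 𝒴 ⊆ 𝕋² be disjoint nonempty finite f_A-invariant sets such that every positive 𝒳-rectangle contains a point of the lift 𝒴̃. Fix x ∈ 𝒳̃; for t > 0 let μ(t) denote the maximum of the set {ℓ^s(R) : R a primitive positive (𝒳,x)-rectangle} ∩ (0,t]. Then: (i) this maximum exists for every t > 0 and there is a unique primitive positive (𝒳,x)-rectangle R(t) with ℓ^s(R(t)) = μ(t); (ii) the set {a > 0 : x + a·v^s + b·v^u ∈ 𝒴̃ ∩ R(t) for some b} has a minimum δ(t), and 0 < δ(t) < μ(t); and (iii) there exists N ∈ ℕ such that for every t > 0 and every integer n ≥ N one has μ(δ(t) + λ^{−n}(t − δ(t))) = μ(δ(t)). -/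

import Mathlib

/- Common setup: following the paper, we identify each subset of the torus
`𝕋² = ℝ²/ℤ²` with its (`ℤ²`-saturated) lift to `ℝ²`. -/

open Matrix Set
open scoped Pointwise

namespace Paper

/-- Points of the plane ℝ². -/
abbrev V : Type := Fin 2 → ℝ

/-- The integer lattice ℤ² ⊆ ℝ². -/
def lattice : Set V := Set.range fun m : Fin 2 → ℤ => fun i => (m i : ℝ)

/-- The linear action of an integer matrix on ℝ². -/
def actR (A : Matrix (Fin 2) (Fin 2) ℤ) (v : V) : V :=
  (A.map (Int.cast : ℤ → ℝ)).mulVec v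

/-- `E ⊆ ℝ²` is the lift of a finite subset of the torus. -/
def IsTorusFinite (E : Set V) : Prop := ∃ F : Set V, F.Finite ∧ E = F + lattice

/-- `E` is the lift of an `f_A`-invariant subset of the torus. -/
def IsInvariant (A : Matrix (Fin 2) (Fin 2) ℤ) (E : Set V) : Prop := actR A '' E = E

/-- `E` is the lift of a periodic orbit of `f_A`. -/
def IsPeriodicOrbit (A : Matrix (Fin 2) (Fin 2) ℤ) (E : Set V) : Prop :=
  ∃ x : V, ∃ p : ℕ, 0 < p ∧ (actR A)^[p] x - x ∈ lattice ∧
    E = {v | ∃ i : ℕ, v - (actR A)^[i] x ∈ lattice}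

/-- A rectangle `R(p; s, u)`, recorded via its basepoint `p` and its side
lengths `s, u > 0` (in the directions of the fixed eigenvectors `v^s, v^u`). -/
structure Rect where
  p : V
  s : ℝ
  u : ℝ
  s_pos : 0 < s
  u_pos : 0 < u

namespace Rect

/-- The set of points of the rectangle `R(p;s,u)`. -/
def carrier (vs vu : V) (R : Rect) : Set V :=
  {q | ∃ a b : ℝ, 0 ≤ a ∧ a ≤ R.s ∧ 0 ≤ b ∧ b ≤ R.u ∧ q = R.p + a • vs + b • vu}

/-- Endpoint of the increasing diagonal (whose origin is `R.p`). -/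
def incEnd (vs vu : V) (R : Rect) : V := R.p + R.s • vs + R.u • vu

/-- Origin of the decreasing diagonal. -/
def decOrigin (vs : V) (R : Rect) : V := R.p + R.s • vs

/-- Endpoint of the decreasing diagonal. -/
def decEnd (vu : V) (R : Rect) : V := R.p + R.u • vu

/-- `R` is a positive `E`-rectangle. -/
def IsPos (vs vu : V) (E : Set V) (R : Rect) : Prop :=
  R.p ∈ E ∧ R.incEnd vs vu ∈ E

/-- `R` is a negative `E`-rectangle. -/
def IsNeg (vs vu : V) (E : Set V) (R : Rect) : Prop :=
  R.decOrigin vs ∈ E ∧ R.decEnd vu ∈ E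

/-- `R` is a primitive positive `E`-rectangle. -/
def IsPrimPos (vs vu : V) (E : Set V) (R : Rect) : Prop :=
  R.IsPos vs vu E ∧ R.carrier vs vu ∩ E = {R.p, R.incEnd vs vu}

/-- `R` is a primitive negative `E`-rectangle. -/
def IsPrimNeg (vs vu : V) (E : Set V) (R : Rect) : Prop :=
  R.IsNeg vs vu E ∧ R.carrier vs vu ∩ E = {R.decOrigin vs, R.decEnd vu}

/-- Bottom stable side of a rectangle. -/
def botSide (vs : V) (R : Rect) : Set V :=
  {q | ∃ a : ℝ, 0 ≤ a ∧ a ≤ R.s ∧ q = R.p + a • vs}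

/-- Top stable side of a rectangle. -/
def topSide (vs vu : V) (R : Rect) : Set V :=
  {q | ∃ a : ℝ, 0 ≤ a ∧ a ≤ R.s ∧ q = R.p + a • vs + R.u • vu}

/-- Left unstable side of a rectangle. -/
def leftSide (vu : V) (R : Rect) : Set V :=
  {q | ∃ b : ℝ, 0 ≤ b ∧ b ≤ R.u ∧ q = R.p + b • vu}

/-- Interior of a rectangle. -/
def interior (vs vu : V) (R : Rect) : Set V :=
  {q | ∃ a b : ℝ, 0 < a ∧ a < R.s ∧ 0 < b ∧ b < R.u ∧ q = R.p + a • vs + b • vu}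

end Rect

/-- The (closed) quadrant `C₊₊(x)`. -/
def quadPP (vs vu x : V) : Set V :=
  {q | ∃ a b : ℝ, 0 ≤ a ∧ 0 ≤ b ∧ q = x + a • vs + b • vu}

/-- `D` is a right horizontal subrectangle of `R`. -/
def IsRightHorizSub (vs : V) (D R : Rect) : Prop :=
  D.s ≤ R.s ∧ D.u = R.u ∧ D.p = R.p + (R.s - D.s) • vs

/-- A positive `X`-string with origin `x`: a sequence of positive `X`-rectangles,
the first one having `x` as origin of its increasing diagonal, consecutive ones
meeting exactly at one point which is the endpoint of the increasing diagonal of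
the former and the origin of the increasing diagonal of the latter. -/
def IsPosString (vs vu : V) (X : Set V) (x : V) (R : ℕ → Rect) : Prop :=
  (∀ i, (R i).IsPos vs vu X) ∧ (R 0).p = x ∧
    ∀ i, (R i).carrier vs vu ∩ (R (i + 1)).carrier vs vu = {(R i).incEnd vs vu} ∧
      (R (i + 1)).p = (R i).incEnd vs vu

/-- A positive `X`-staircase with origin `x`. -/
def IsPosStaircase (vs vu : V) (X : Set V) (x : V) (R : ℕ → Rect) : Prop :=
  (∀ i, (R i).carrier vs vu ⊆ quadPP vs vu x) ∧
    ∃ Del : ℕ → Rect, IsPosString vs vu X x Del ∧ R 0 = Del 0 ∧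
      (∀ i, 1 ≤ i → IsRightHorizSub vs (Del i) (R i)) ∧
      (∀ i, (R i).topSide vs vu ⊆ (R (i + 1)).botSide vs) ∧
      ∃ C : ℝ, ∀ i, (Del (i + 1)).s / (Del i).s ≤ C

/-- Stable side lengths of the primitive positive `(X, x)`-rectangles. -/
def baseLengths (vs vu : V) (X : Set V) (x : V) : Set ℝ :=
  {s | ∃ R : Rect, R.IsPrimPos vs vu X ∧ R.p = x ∧ R.s = s}

/-- The Euclidean norm of a point of ℝ². -/
noncomputable def euclNorm (v : V) : ℝ := Real.sqrt ((v 0) ^ 2 + (v 1) ^ 2)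

/-- `Y` is the lift of an `ε`-dense subset of the torus, for the metric on the
torus induced by the Euclidean metric of ℝ². -/
def EDense (ε : ℝ) (Y : Set V) : Prop := ∀ v : V, ∃ y ∈ Y, euclNorm (v - y) ≤ ε

/-- The lift of `{(0,1/2), (1/2,0), (1/2,1/2)}`, i.e. the set
`{(0,1/2), (1/2,0), (1/2,1/2)} + ℤ²`. -/
def halfPoints : Set V :=
  {v : V | ∃ w ∈ ({![0, 1/2], ![1/2, 0], ![1/2, 1/2]} : Set V), v - w ∈ lattice}

/-- The lift of the point `(1/2,1/2)` of the torus, i.e. `(1/2,1/2) + ℤ²`. -/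
def halfCenter : Set V := {v : V | v - ![1/2, 1/2] ∈ lattice}

lemma exists_pos_le_of_finite {S : Set ℝ} (hS : S.Finite) :
    ∃ ε > 0, ∀ s ∈ S, 0 < s → ε ≤ s := by
  have hf : (S ∩ Ioi 0).Finite := hS.subset inter_subset_left
  rcases (S ∩ Ioi 0).eq_empty_or_nonempty with he | hne
  · refine ⟨1, one_pos, fun s hs h0 => ?_⟩
    have : s ∈ S ∩ Ioi 0 := ⟨hs, h0⟩
    rw [he] at this
    exact this.elim
  · obtain ⟨m, hm, hmin⟩ := exists_min_image _ id hf hne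
    exact ⟨m, hm.2, fun s hs h0 => hmin s ⟨hs, h0⟩⟩

/-- Only finitely many points of `D` lie in any bounded box. -/
def BoxFinite (D : Set (ℝ × ℝ)) : Prop :=
  ∀ K : ℝ, {p ∈ D | |p.1| ≤ K ∧ |p.2| ≤ K}.Finite

/-- `D` is invariant under the hyperbolic map `(a, b) ↦ (c⁻¹ a, c b)`. -/
def HypInvariant (c : ℝ) (D : Set (ℝ × ℝ)) : Prop :=
  ∀ p : ℝ × ℝ, p ∈ D ↔ (c⁻¹ * p.1, c * p.2) ∈ D

lemma HypInvariant.zpow {c : ℝ} (hc : 0 < c) {D : Set (ℝ × ℝ)} (h : HypInvariant c D) (k : ℤ) :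
    HypInvariant (c ^ k) D := by
  have hc' := hc.ne'
  induction k using Int.induction_on with
  | zero => intro p; simp
  | succ n ih =>
    intro p
    rw [ih p, h (_, _), zpow_add_one₀ hc']
    simp only [mul_inv]
    ring_nf
  | pred n ih =>
    intro p
    rw [ih p, zpow_sub_one₀ hc']
    have e1 : c⁻¹ * ((c ^ (-(n : ℤ)) * c⁻¹)⁻¹ * p.1) = (c ^ (-(n : ℤ)))⁻¹ * p.1 := by
      rw [mul_inv, inv_inv]; field_simp
    have e2 : c * ((c ^ (-(n : ℤ)) * c⁻¹) * p.2) = c ^ (-(n : ℤ)) * p.2 := by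
      field_simp
    have h' := h ((c ^ (-(n : ℤ)) * c⁻¹)⁻¹ * p.1, c ^ (-(n : ℤ)) * c⁻¹ * p.2)
    rw [e1, e2] at h'
    exact h'.symm

lemma HypInvariant.inv {c : ℝ} {D : Set (ℝ × ℝ)} (h : HypInvariant c D) (hc : 0 < c) :
    HypInvariant c⁻¹ D := by
  simpa using h.zpow hc (-1)

/-- A box-finite hyperbolically invariant set meets the coordinate axes at most at the origin. -/
lemma snd_eq_zero_of_fst_eq_zero {c : ℝ} (hc : 1 < c) {D : Set (ℝ × ℝ)} (hf : BoxFinite D)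
    (h : HypInvariant c D) {b : ℝ} (hb : (0, b) ∈ D) : b = 0 := by
  by_contra hb0
  have hc0 : 0 < c := one_pos.trans hc
  have hinj : Function.Injective fun n : ℕ => ((0 : ℝ), c⁻¹ ^ n * b) := by
    intro m n hmn
    have h1 : c⁻¹ ^ m = c⁻¹ ^ n := mul_right_cancel₀ hb0 (congrArg Prod.snd hmn)
    exact pow_right_injective₀ (inv_pos.2 hc0) (inv_lt_one_of_one_lt₀ hc).ne h1
  refine infinite_of_injective_forall_mem hinj (fun n => ?_) (hf |b|)
  have h2 := (h.zpow hc0 (-(n : ℤ)) (0, b)).1 hb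
  refine ⟨?_, by simp, ?_⟩
  · simpa [_root_.zpow_neg] using h2
  · rw [abs_mul, abs_of_nonneg (by positivity)]
    exact mul_le_of_le_one_left (abs_nonneg b)
      (pow_le_one₀ (inv_pos.2 hc0).le (inv_le_one_of_one_le₀ hc.le))

lemma fst_eq_zero_of_snd_eq_zero {c : ℝ} (hc : 1 < c) {D : Set (ℝ × ℝ)} (hf : BoxFinite D)
    (h : HypInvariant c D) {a : ℝ} (ha : (a, 0) ∈ D) : a = 0 := by
  by_contra ha0
  have hc0 : 0 < c := one_pos.trans hc
  have hinj : Function.Injective fun n : ℕ => (c⁻¹ ^ n * a, (0 : ℝ)) := by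
    intro m n hmn
    have h1 : c⁻¹ ^ m = c⁻¹ ^ n := mul_right_cancel₀ ha0 (congrArg Prod.fst hmn)
    exact pow_right_injective₀ (inv_pos.2 hc0) (inv_lt_one_of_one_lt₀ hc).ne h1
  refine infinite_of_injective_forall_mem hinj (fun n => ?_) (hf |a|)
  have h2 := (h.zpow hc0 (n : ℤ) (a, 0)).1 ha
  refine ⟨?_, ?_, by simp⟩
  · simpa using h2
  · rw [abs_mul, abs_of_nonneg (by positivity)]
    exact mul_le_of_le_one_left (abs_nonneg a)
      (pow_le_one₀ (inv_pos.2 hc0).le (inv_le_one_of_one_le₀ hc.le))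

/-- Any vertical strip contains a point of `D` in the open quadrant, as soon as the quadrant
does. -/
lemma exists_mem_strip {c : ℝ} (hc : 1 < c) {D : Set (ℝ × ℝ)} (h : HypInvariant c D)
    (hne : ∃ p ∈ D, 0 < p.1 ∧ 0 < p.2) {t : ℝ} (ht : 0 < t) :
    ∃ p ∈ D, 0 < p.1 ∧ p.1 ≤ t ∧ 0 < p.2 := by
  obtain ⟨p, hp, h1, h2⟩ := hne
  have hc0 : 0 < c := one_pos.trans hc
  obtain ⟨n, hn⟩ := exists_pow_lt_of_lt_one (div_pos ht h1) (inv_lt_one_of_one_lt₀ hc)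
  refine ⟨_, (h.zpow hc0 n p).1 hp, by positivity, ?_, by positivity⟩
  rw [zpow_natCast, ← inv_pow]
  exact ((lt_div_iff₀ h1).1 hn).le

/-- `m` is the lowest point of `D` in the strip `0 < a ≤ t` of the open quadrant. -/
structure IsLowest (D : Set (ℝ × ℝ)) (t : ℝ) (m : ℝ × ℝ) : Prop where
  mem : m ∈ D
  fst_pos : 0 < m.1
  fst_le : m.1 ≤ t
  snd_pos : 0 < m.2
  le : ∀ p ∈ D, 0 < p.1 → p.1 ≤ t → 0 < p.2 → m.2 ≤ p.2

/-- `d` is the leftmost point of `E` in the box with corner `m`, excluding the vertical axis. -/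
structure IsLeftmost (E : Set (ℝ × ℝ)) (m d : ℝ × ℝ) : Prop where
  mem : d ∈ E
  fst_pos : 0 < d.1
  fst_lt : d.1 < m.1
  snd_nonneg : 0 ≤ d.2
  snd_le : d.2 ≤ m.2
  le : ∀ p ∈ E, 0 < p.1 → p.1 ≤ m.1 → 0 ≤ p.2 → p.2 ≤ m.2 → d.1 ≤ p.1

lemma exists_isLowest {D : Set (ℝ × ℝ)} (hf : BoxFinite D) {t : ℝ}
    (hne : ∃ p ∈ D, 0 < p.1 ∧ p.1 ≤ t ∧ 0 < p.2) : ∃ m, IsLowest D t m := by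
  obtain ⟨q, hq, hq1, hqt, hq2⟩ := hne
  have hfin : {p ∈ D | 0 < p.1 ∧ p.1 ≤ t ∧ 0 < p.2 ∧ p.2 ≤ q.2}.Finite := by
    refine (hf (max t q.2)).subset ?_
    rintro p ⟨hp, h1, h2, h3, h4⟩
    refine ⟨hp, ?_, ?_⟩
    · rw [abs_of_pos h1]; exact h2.trans (le_max_left _ _)
    · rw [abs_of_pos h3]; exact h4.trans (le_max_right _ _)
  obtain ⟨m, ⟨hm, h1, h2, h3, h4⟩, hmin⟩ :=
    exists_min_image _ Prod.snd hfin ⟨q, hq, hq1, hqt, hq2, le_rfl⟩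
  refine ⟨m, hm, h1, h2, h3, fun p hp p1 pt p2 => ?_⟩
  rcases le_total p.2 q.2 with h | h
  · exact hmin p ⟨hp, p1, pt, p2, h⟩
  · exact h4.trans h

lemma exists_isLeftmost {E : Set (ℝ × ℝ)} (hf : BoxFinite E) {m : ℝ × ℝ}
    (hne : ∃ p ∈ E, 0 < p.1 ∧ p.1 ≤ m.1 ∧ 0 ≤ p.2 ∧ p.2 ≤ m.2)
    (hm : ∀ p ∈ E, p.1 ≠ m.1) : ∃ d, IsLeftmost E m d := by
  have hfin : {p ∈ E | 0 < p.1 ∧ p.1 ≤ m.1 ∧ 0 ≤ p.2 ∧ p.2 ≤ m.2}.Finite := by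
    refine (hf (max m.1 m.2)).subset ?_
    rintro p ⟨hp, h1, h2, h3, h4⟩
    refine ⟨hp, ?_, ?_⟩
    · rw [abs_of_pos h1]; exact h2.trans (le_max_left _ _)
    · rw [abs_of_nonneg h3]; exact h4.trans (le_max_right _ _)
  obtain ⟨d, ⟨hd, h1, h2, h3, h4⟩, hmin⟩ := exists_min_image _ Prod.fst hfin hne
  exact ⟨d, hd, h1, lt_of_le_of_ne h2 (hm d hd), h3, h4,
    fun p hp p1 p2 p3 p4 => hmin p ⟨hp, p1, p2, p3, p4⟩⟩

lemma IsLowest.snd_antitone {D : Set (ℝ × ℝ)} {s t : ℝ} {m n : ℝ × ℝ}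
    (hm : IsLowest D s m) (hn : IsLowest D t n) (hst : s ≤ t) : n.2 ≤ m.2 :=
  hn.le m hm.mem hm.fst_pos (hm.fst_le.trans hst) hm.snd_pos

lemma IsLowest.scale {D : Set (ℝ × ℝ)} {r t : ℝ} (hr : 0 < r) (h : HypInvariant r D)
    {m : ℝ × ℝ} (hm : IsLowest D t m) : IsLowest D (r⁻¹ * t) (r⁻¹ * m.1, r * m.2) := by
  have hr' := inv_pos.2 hr
  refine ⟨(h m).1 hm.mem, mul_pos hr' hm.fst_pos, mul_le_mul_of_nonneg_left hm.fst_le hr'.le,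
    mul_pos hr hm.snd_pos, fun p hp h1 h2 h3 => ?_⟩
  have := hm.le _ ((h.inv hr p).1 hp) (by simp only [inv_inv]; positivity)
    (by simp only [inv_inv]; exact (le_inv_mul_iff₀ hr).1 h2) (by positivity)
  exact (le_inv_mul_iff₀ hr).1 this

lemma IsLeftmost.scale {E : Set (ℝ × ℝ)} {r : ℝ} (hr : 0 < r) (h : HypInvariant r E)
    {m d : ℝ × ℝ} (hd : IsLeftmost E m d) :
    IsLeftmost E (r⁻¹ * m.1, r * m.2) (r⁻¹ * d.1, r * d.2) := by
  have hr' := inv_pos.2 hr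
  refine ⟨(h d).1 hd.mem, mul_pos hr' hd.fst_pos, mul_lt_mul_of_pos_left hd.fst_lt hr',
    mul_nonneg hr.le hd.snd_nonneg, mul_le_mul_of_nonneg_left hd.snd_le hr.le,
    fun p hp h1 h2 h3 h4 => ?_⟩
  have := hd.le _ ((h.inv hr p).1 hp) (by simp only [inv_inv]; positivity)
    (by simp only [inv_inv]; exact (le_inv_mul_iff₀ hr).1 h2) (by positivity)
    ((inv_mul_le_iff₀ hr).2 h4)
  rw [inv_inv] at this
  exact (inv_mul_le_iff₀ hr).2 this

lemma IsLeftmost.fst_unique {E : Set (ℝ × ℝ)} {m d d' : ℝ × ℝ}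
    (h : IsLeftmost E m d) (h' : IsLeftmost E m d') : d.1 = d'.1 :=
  le_antisymm (h.le d' h'.mem h'.fst_pos h'.fst_lt.le h'.snd_nonneg h'.snd_le)
    (h'.le d h.mem h.fst_pos h.fst_lt.le h.snd_nonneg h.snd_le)

/-- Uniform stabilization of the lowest points just to the right of the leftmost points. -/
lemma exists_stabilization {c : ℝ} (hc : 1 < c) {D E : Set (ℝ × ℝ)}
    (hDf : BoxFinite D) (hEf : BoxFinite E) (hD : HypInvariant c D) (hE : HypInvariant c E)
    (hinj : ∀ p ∈ D, ∀ q ∈ D, p.2 = q.2 → p = q)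
    {M d : ℝ → ℝ × ℝ} (hM : ∀ t, 0 < t → IsLowest D t (M t))
    (hd : ∀ t, 0 < t → IsLeftmost E (M t) (d t)) :
    ∃ η > 0, ∀ t, 0 < t → ∀ e, 0 ≤ e → e ≤ η →
      M ((d t).1 + e * (t - (d t).1)) = M (d t).1 := by
  have hc0 : 0 < c := one_pos.trans hc
  have huniq : ∀ {t m}, 0 < t → IsLowest D t m → M t = m := fun ht hm =>
    hinj _ (hM _ ht).mem _ hm.mem
      (le_antisymm (hm.snd_antitone (hM _ ht) le_rfl) ((hM _ ht).snd_antitone hm le_rfl))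
  have hlt : ∀ t, 0 < t → (d t).1 < t := fun t ht =>
    (hd t ht).fst_lt.trans_le (hM t ht).fst_le
  -- The claim on the fundamental domain `[1, c]`.
  obtain ⟨η, hη, hfund⟩ : ∃ η > 0, ∀ t, 1 ≤ t → t ≤ c → ∀ e, 0 ≤ e → e ≤ η →
      M ((d t).1 + e * (t - (d t).1)) = M (d t).1 := by
    set SE := {p ∈ E | |p.1| ≤ max c (M 1).2 ∧ |p.2| ≤ max c (M 1).2}
    have hSE : SE.Finite := hEf _
    have hdSE : ∀ t, 1 ≤ t → t ≤ c → d t ∈ SE := by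
      intro t h1 h2
      have ht : 0 < t := one_pos.trans_le h1
      refine ⟨(hd t ht).mem, ?_, ?_⟩
      · rw [abs_of_pos (hd t ht).fst_pos]
        exact ((hlt t ht).le.trans h2).trans (le_max_left _ _)
      · rw [abs_of_nonneg (hd t ht).snd_nonneg]
        exact ((hd t ht).snd_le.trans ((hM 1 one_pos).snd_antitone (hM t ht) h1)).trans
          (le_max_right _ _)
    obtain ⟨δ₀, hδ₀, hδ₀le⟩ := exists_pos_le_of_finite (hSE.image Prod.fst)
    set SD := {p ∈ D | |p.1| ≤ max c (M δ₀).2 ∧ |p.2| ≤ max c (M δ₀).2}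
    have hSD : SD.Finite := hDf _
    have hMSD : ∀ t, δ₀ ≤ t → t ≤ c → M t ∈ SD := by
      intro t h1 h2
      have ht : 0 < t := hδ₀.trans_le h1
      refine ⟨(hM t ht).mem, ?_, ?_⟩
      · rw [abs_of_pos (hM t ht).fst_pos]
        exact ((hM t ht).fst_le.trans h2).trans (le_max_left _ _)
      · rw [abs_of_pos (hM t ht).snd_pos]
        exact ((hM δ₀ hδ₀).snd_antitone (hM t ht) h1).trans (le_max_right _ _)
    obtain ⟨ε, hε, hεle⟩ :=
      exists_pos_le_of_finite (hSD.image2 (fun p q : ℝ × ℝ => p.1 - q.1) hSE)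
    refine ⟨min 1 (ε / (2 * c)), by positivity, fun t h1 h2 e he0 he => ?_⟩
    have ht : 0 < t := one_pos.trans_le h1
    have hd0 := (hd t ht).fst_pos
    have hdt := hlt t ht
    have hdδ : δ₀ ≤ (d t).1 := hδ₀le _ ⟨_, hdSE t h1 h2, rfl⟩ hd0
    set t' := (d t).1 + e * (t - (d t).1) with ht'
    have hge : (d t).1 ≤ t' := le_add_of_nonneg_right (mul_nonneg he0 (sub_pos.2 hdt).le)
    have he1 : e * (t - (d t).1) ≤ 1 * (t - (d t).1) :=
      mul_le_mul_of_nonneg_right (he.trans (min_le_left _ _)) (sub_pos.2 hdt).le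
    have he2 : e * (t - (d t).1) ≤ ε / (2 * c) * c :=
      mul_le_mul (he.trans (min_le_right _ _)) (by linarith) (sub_pos.2 hdt).le (by positivity)
    have he3 : ε / (2 * c) * c = ε / 2 := by field_simp
    have ht'0 : 0 < t' := hd0.trans_le hge
    have hmem := hMSD t' (hdδ.trans hge) (by linarith)
    have hfst : (M t').1 ≤ (d t).1 := by
      by_contra! hcon
      have := hεle _ ⟨_, hmem, _, hdSE t h1 h2, rfl⟩ (sub_pos.2 hcon)
      have := (hM t' ht'0).fst_le
      linarith
    have hM' := hM t' ht'0
    exact (huniq hd0 ⟨hM'.mem, hM'.fst_pos, hfst, hM'.snd_pos,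
      fun p hp p1 p2 p3 => hM'.le p hp p1 (p2.trans hge) p3⟩).symm
  refine ⟨η, hη, fun t ht e he0 he => ?_⟩
  obtain ⟨k, hk1, hk2⟩ := exists_mem_Ico_zpow ht hc
  set r := c ^ k with hr
  have hr0 : 0 < r := zpow_pos hc0 k
  have hDr : HypInvariant r D := hD.zpow hc0 k
  have hEr : HypInvariant r E := hE.zpow hc0 k
  have hscale : ∀ s, 0 < s → M (r⁻¹ * s) = (r⁻¹ * (M s).1, r * (M s).2) := fun s hs =>
    huniq (by positivity) ((hM s hs).scale hr0 hDr)
  have h1 : 1 ≤ r⁻¹ * t := (le_inv_mul_iff₀ hr0).2 (by simpa using hk1)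
  have h2 : r⁻¹ * t ≤ c := (inv_mul_le_iff₀ hr0).2 (by
    rw [hr, ← zpow_add_one₀ hc0.ne']; exact hk2.le)
  have hdscale : (d (r⁻¹ * t)).1 = r⁻¹ * (d t).1 := by
    have ha := hd (r⁻¹ * t) (by positivity)
    rw [hscale t ht] at ha
    exact ha.fst_unique ((hd t ht).scale hr0 hEr)
  have hfin := hfund _ h1 h2 e he0 he
  have hd0 := (hd t ht).fst_pos
  have harg : 0 < (d t).1 + e * (t - (d t).1) :=
    add_pos_of_pos_of_nonneg hd0 (mul_nonneg he0 (sub_pos.2 (hlt t ht)).le)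
  rw [hdscale, show r⁻¹ * (d t).1 + e * (r⁻¹ * t - r⁻¹ * (d t).1)
    = r⁻¹ * ((d t).1 + e * (t - (d t).1)) by ring, hscale _ harg, hscale _ hd0] at hfin
  exact Prod.ext (mul_left_cancel₀ (inv_pos.2 hr0).ne' (congrArg Prod.fst hfin))
    (mul_left_cancel₀ hr0.ne' (congrArg Prod.snd hfin))

/-- The set `E` in the coordinates of the frame `vs, vu` centred at `x`. -/
def coords (vs vu x : V) (E : Set V) : Set (ℝ × ℝ) := {p | x + p.1 • vs + p.2 • vu ∈ E}

section Action

variable (A : Matrix (Fin 2) (Fin 2) ℤ)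

lemma actR_add (v w : V) : actR A (v + w) = actR A v + actR A w := Matrix.mulVec_add _ v w

lemma actR_sub (v w : V) : actR A (v - w) = actR A v - actR A w := Matrix.mulVec_sub _ v w

lemma actR_smul (a : ℝ) (v : V) : actR A (a • v) = a • actR A v := Matrix.mulVec_smul _ a v

lemma actR_mem_lattice {v : V} (hv : v ∈ lattice) : actR A v ∈ lattice := by
  obtain ⟨m, rfl⟩ := hv
  refine ⟨A.mulVec m, ?_⟩
  ext i
  simp [actR, Matrix.mulVec, dotProduct]

lemma adjugate_actR (hdet : A.det = 1) (v : V) : actR A.adjugate (actR A v) = v := by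
  have h : (A.adjugate.map (Int.cast : ℤ → ℝ)) * A.map (Int.cast : ℤ → ℝ) = 1 := by
    have e : A.adjugate.map (Int.castRingHom ℝ) * A.map (Int.castRingHom ℝ) = 1 := by
      rw [← Matrix.map_mul, Matrix.adjugate_mul, hdet, one_smul,
        Matrix.map_one _ (map_zero _) (map_one _)]
    exact e
  rw [actR, actR, Matrix.mulVec_mulVec, h, Matrix.one_mulVec]

lemma actR_injective (hdet : A.det = 1) : Function.Injective (actR A) :=
  Function.LeftInverse.injective (adjugate_actR A hdet)

lemma mem_lattice_of_actR (hdet : A.det = 1) {v : V} (hv : actR A v ∈ lattice) : v ∈ lattice := by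
  rw [← adjugate_actR A hdet v]
  exact actR_mem_lattice _ hv

variable {A}

lemma IsInvariant.actR_mem_iff (hdet : A.det = 1) {E : Set V} (hE : IsInvariant A E) (v : V) :
    actR A v ∈ E ↔ v ∈ E := by
  conv_lhs => rw [← show actR A '' E = E from hE]
  exact (actR_injective A hdet).mem_set_image

lemma IsInvariant.iterate_mem_iff (hdet : A.det = 1) {E : Set V} (hE : IsInvariant A E) (n : ℕ)
    (v : V) : (actR A)^[n] v ∈ E ↔ v ∈ E := by
  induction n with
  | zero => rfl
  | succ n ih => rw [Function.iterate_succ_apply', hE.actR_mem_iff hdet, ih]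

lemma mem_lattice_of_iterate_sub (hdet : A.det = 1) (n : ℕ) {v w : V}
    (h : (actR A)^[n] v - (actR A)^[n] w ∈ lattice) : v - w ∈ lattice := by
  induction n with
  | zero => exact h
  | succ n ih =>
    rw [Function.iterate_succ_apply', Function.iterate_succ_apply', ← actR_sub] at h
    exact ih (mem_lattice_of_actR A hdet h)

lemma iterate_actR_frame {lam : ℝ} {vs vu : V} (hAs : actR A vs = lam⁻¹ • vs)
    (hAu : actR A vu = lam • vu) (x : V) (a b : ℝ) (n : ℕ) :
    (actR A)^[n] (x + a • vs + b • vu)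
      = (actR A)^[n] x + ((lam ^ n)⁻¹ * a) • vs + (lam ^ n * b) • vu := by
  induction n with
  | zero => simp
  | succ n ih =>
    rw [Function.iterate_succ_apply', Function.iterate_succ_apply', ih, actR_add, actR_add,
      actR_smul, actR_smul, hAs, hAu, smul_smul, smul_smul, pow_succ, mul_inv]
    ring_nf

end Action

lemma add_mem_lattice {v w : V} (hv : v ∈ lattice) (hw : w ∈ lattice) : v + w ∈ lattice := by
  obtain ⟨m, rfl⟩ := hv
  obtain ⟨n, rfl⟩ := hw
  exact ⟨m + n, by ext i; simp⟩

lemma neg_mem_lattice {v : V} (hv : v ∈ lattice) : -v ∈ lattice := by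
  obtain ⟨m, rfl⟩ := hv
  exact ⟨-m, by ext i; simp⟩

lemma IsTorusFinite.add_mem {E : Set V} (hE : IsTorusFinite E) {v w : V} (hv : v ∈ E)
    (hw : w ∈ lattice) : v + w ∈ E := by
  obtain ⟨F, -, rfl⟩ := hE
  obtain ⟨f, hf, l, hl, rfl⟩ := hv
  exact ⟨f, hf, l + w, add_mem_lattice hl hw, (add_assoc f l w).symm⟩

lemma IsTorusFinite.add_mem_iff {E : Set V} (hE : IsTorusFinite E) {v w : V}
    (hw : w ∈ lattice) : v + w ∈ E ↔ v ∈ E :=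
  ⟨fun h => by simpa using hE.add_mem h (neg_mem_lattice hw), fun h => hE.add_mem h hw⟩

lemma IsTorusFinite.union {E E' : Set V} (h : IsTorusFinite E) (h' : IsTorusFinite E') :
    IsTorusFinite (E ∪ E') := by
  obtain ⟨F, hF, rfl⟩ := h
  obtain ⟨F', hF', rfl⟩ := h'
  exact ⟨F ∪ F', hF.union hF', union_add.symm⟩

lemma IsTorusFinite.sub_self {E : Set V} (h : IsTorusFinite E) : IsTorusFinite (E - E) := by
  obtain ⟨F, hF, rfl⟩ := h
  refine ⟨F - F, hF.sub hF, Subset.antisymm ?_ ?_⟩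
  · rintro _ ⟨_, ⟨f, hf, l, hl, rfl⟩, _, ⟨g, hg, m, hm, rfl⟩, rfl⟩
    exact ⟨f - g, ⟨f, hf, g, hg, rfl⟩, l + -m, add_mem_lattice hl (neg_mem_lattice hm), by
      simp only; abel⟩
  · rintro _ ⟨_, ⟨f, hf, g, hg, rfl⟩, l, hl, rfl⟩
    exact ⟨f + l, ⟨f, hf, l, hl, rfl⟩, g + 0, ⟨g, hg, 0, ⟨0, by ext; simp⟩, rfl⟩, by
      simp only; abel⟩

lemma IsInvariant.union {A : Matrix (Fin 2) (Fin 2) ℤ} {E E' : Set V} (h : IsInvariant A E)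
    (h' : IsInvariant A E') : IsInvariant A (E ∪ E') := by
  rw [IsInvariant, image_union, h, h']

lemma IsInvariant.sub_self {A : Matrix (Fin 2) (Fin 2) ℤ} {E : Set V} (h : IsInvariant A E) :
    IsInvariant A (E - E) := by
  have := image_image2_distrib (f := fun v w : V => v - w) (g := actR A) (s := E) (t := E)
    (actR_sub A)
  rw [show actR A '' E = E from h] at this
  exact this

/-- Every periodic point of the torus returns modulo the lattice. -/
lemma exists_return {A : Matrix (Fin 2) (Fin 2) ℤ} (hdet : A.det = 1) {X : Set V}
    (hf : IsTorusFinite X) (hi : IsInvariant A X) {x : V} (hx : x ∈ X) :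
    ∃ p : ℕ, 0 < p ∧ (actR A)^[p] x - x ∈ lattice := by
  obtain ⟨F, hF, rfl⟩ := hf
  have hmem : ∀ n : ℕ, ∃ f ∈ F, (actR A)^[n] x - f ∈ lattice := by
    intro n
    obtain ⟨f, hf, l, hl, e⟩ := (hi.iterate_mem_iff hdet n x).2 hx
    exact ⟨f, hf, by rw [← e]; simpa using hl⟩
  choose g hgF hg using hmem
  obtain ⟨m, n, hmn, e⟩ := hF.exists_lt_map_eq_of_forall_mem (f := g) hgF
  refine ⟨n - m, Nat.sub_pos_of_lt hmn, mem_lattice_of_iterate_sub hdet m ?_⟩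
  rw [← Function.iterate_add_apply, Nat.add_sub_cancel' hmn.le]
  have := add_mem_lattice (hg n) (neg_mem_lattice (hg m))
  rw [e] at this
  convert this using 1
  abel

lemma frame_det_ne_zero {A : Matrix (Fin 2) (Fin 2) ℤ} {lam : ℝ} (hlam : 1 < lam) {vs vu : V}
    (hvs : vs ≠ 0) (hvu : vu ≠ 0) (hAs : actR A vs = lam⁻¹ • vs) (hAu : actR A vu = lam • vu) :
    vs 0 * vu 1 - vs 1 * vu 0 ≠ 0 := by
  have hne : lam - lam⁻¹ ≠ 0 := (sub_pos.2 ((inv_lt_one_of_one_lt₀ hlam).trans hlam)).ne'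
  have key : ∀ a b : ℝ, a • vs + b • vu = 0 → a = 0 ∧ b = 0 := by
    intro a b h
    have h1 : actR A (a • vs + b • vu) = actR A 0 := by rw [h]
    have h2 : actR A 0 = 0 := Matrix.mulVec_zero _
    rw [actR_add, actR_smul, actR_smul, hAs, hAu, h2] at h1
    have h3 : ((lam - lam⁻¹) * b) • vu = 0 := by
      have : ((lam - lam⁻¹) * b) • vu
          = (a • lam⁻¹ • vs + b • lam • vu) - lam⁻¹ • (a • vs + b • vu) := by module
      rw [this, h1, h]; simp
    have hb : b = 0 := by simpa [hne, hvu] using h3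
    refine ⟨?_, hb⟩
    simpa [hb, hvs] using h
  intro h0
  obtain ⟨-, h1⟩ := key (vu 1) (-(vs 1)) (by
    ext i; fin_cases i <;> simp <;> linarith)
  obtain ⟨-, h2⟩ := key (vu 0) (-(vs 0)) (by
    ext i; fin_cases i <;> simp <;> linarith)
  apply hvs
  ext i
  fin_cases i
  · exact neg_eq_zero.1 h2
  · exact neg_eq_zero.1 h1

lemma frame_injective {vs vu : V} (hd : vs 0 * vu 1 - vs 1 * vu 0 ≠ 0) (x : V) :
    Function.Injective fun p : ℝ × ℝ => x + p.1 • vs + p.2 • vu := by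
  intro p q h
  have h0 := congrFun h 0
  have h1 := congrFun h 1
  simp only [Pi.add_apply, Pi.smul_apply, smul_eq_mul] at h0 h1
  refine Prod.ext (mul_right_cancel₀ hd ?_) (mul_right_cancel₀ hd ?_)
  · linear_combination vu 1 * h0 - vu 0 * h1
  · linear_combination vs 0 * h1 - vs 1 * h0

lemma IsTorusFinite.boxFinite_coords {vs vu : V} (hd : vs 0 * vu 1 - vs 1 * vu 0 ≠ 0) (x : V)
    {E : Set V} (hE : IsTorusFinite E) : BoxFinite (coords vs vu x E) := by
  obtain ⟨F, hF, rfl⟩ := hE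
  intro K
  have hinj := frame_injective hd x
  let B : V → Fin 2 → ℤ := fun f i => ⌈|x i| + K * |vs i| + K * |vu i| + |f i|⌉
  have hfin : (⋃ f ∈ F, (fun m : Fin 2 → ℤ => (f + fun i => (m i : ℝ) : V)) ''
      Icc (-B f) (B f)).Finite := hF.biUnion fun f _ => (finite_Icc _ _).image _
  refine (hfin.preimage hinj.injOn).subset ?_
  rintro p ⟨⟨f, hf, _, ⟨m, rfl⟩, e⟩, hp1, hp2⟩
  refine mem_biUnion hf ⟨m, ?_, e⟩
  have hm : ∀ i, |m i| ≤ B f i := by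
    intro i
    refine Int.cast_le (R := ℝ).1 (le_trans ?_ (Int.le_ceil _))
    have ei := congrFun e i
    simp only [Pi.add_apply, Pi.smul_apply, smul_eq_mul] at ei
    have h1 : |p.1 * vs i| ≤ K * |vs i| := by
      rw [abs_mul]; exact mul_le_mul_of_nonneg_right hp1 (abs_nonneg _)
    have h2 : |p.2 * vu i| ≤ K * |vu i| := by
      rw [abs_mul]; exact mul_le_mul_of_nonneg_right hp2 (abs_nonneg _)
    have e' : (m i : ℝ) = x i + p.1 * vs i + p.2 * vu i - f i := by linarith
    rw [Int.cast_abs, e']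
    have a1 := abs_sub (x i + p.1 * vs i + p.2 * vu i) (f i)
    have a2 := abs_add_three (x i) (p.1 * vs i) (p.2 * vu i)
    linarith
  exact ⟨fun i => neg_le_of_abs_le (hm i), fun i => le_of_abs_le (hm i)⟩

lemma hypInvariant_coords {A : Matrix (Fin 2) (Fin 2) ℤ} (hdet : A.det = 1) {lam : ℝ}
    {vs vu : V} (hAs : actR A vs = lam⁻¹ • vs) (hAu : actR A vu = lam • vu) {x : V} {n : ℕ}
    (hx : (actR A)^[n] x - x ∈ lattice) {E : Set V} (hf : IsTorusFinite E)
    (hi : IsInvariant A E) : HypInvariant (lam ^ n) (coords vs vu x E) := by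
  rintro ⟨a, b⟩
  change x + a • vs + b • vu ∈ E ↔ x + ((lam ^ n)⁻¹ * a) • vs + (lam ^ n * b) • vu ∈ E
  rw [← hi.iterate_mem_iff hdet n, iterate_actR_frame hAs hAu, ← hf.add_mem_iff hx]
  conv_rhs => rw [← hf.add_mem_iff hx]
  rw [← hf.add_mem_iff (neg_mem_lattice hx)]
  refine iff_of_eq (congrArg (· ∈ E) ?_)
  abel

/-- The lift of a nonempty finite subset of the torus meets the open quadrant at any point. -/
lemma exists_mem_quadrant {vs vu : V} (hd : vs 0 * vu 1 - vs 1 * vu 0 ≠ 0) {E : Set V}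
    (hE : IsTorusFinite E) {x : V} (hx : x ∈ E) :
    ∃ p ∈ coords vs vu x E, 0 < p.1 ∧ 0 < p.2 := by
  set det := vs 0 * vu 1 - vs 1 * vu 0 with hdet
  set K : ℝ := (|vu 0| + |vu 1| + |vs 0| + |vs 1|) / |det| + 1
  let w : V := K • vs + K • vu
  let r : V := fun i => Int.fract (w i)
  have hr : ∀ i, |r i| ≤ 1 := fun i => by
    rw [abs_of_nonneg (Int.fract_nonneg _)]; exact (Int.fract_lt_one _).le
  have hbound : ∀ u : V, |u 0| + |u 1| ≤ |vu 0| + |vu 1| + |vs 0| + |vs 1| →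
      (r 0 * u 1 - r 1 * u 0) / det < K := by
    intro u hu
    refine lt_of_le_of_lt ?_ (lt_add_one _)
    refine (le_abs_self _).trans ?_
    rw [abs_div]
    refine div_le_div_of_nonneg_right (le_trans ?_ hu) (abs_nonneg _)
    have b1 := abs_sub (r 0 * u 1) (r 1 * u 0)
    rw [abs_mul, abs_mul] at b1
    have b2 := mul_le_of_le_one_left (abs_nonneg (u 1)) (hr 0)
    have b3 := mul_le_of_le_one_left (abs_nonneg (u 0)) (hr 1)
    linarith
  refine ⟨(K - (r 0 * vu 1 - r 1 * vu 0) / det, K - (r 0 * (-vs) 1 - r 1 * (-vs) 0) / det),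
    ?_, sub_pos.2 (hbound vu ?_), sub_pos.2 (hbound (-vs) ?_)⟩
  · have : x + (K - (r 0 * vu 1 - r 1 * vu 0) / det) • vs
        + (K - (r 0 * (-vs) 1 - r 1 * (-vs) 0) / det) • vu
        = x + fun i => ((⌊w i⌋ : ℤ) : ℝ) := by
      have hfl : ∀ i, ((⌊w i⌋ : ℤ) : ℝ) = K * vs i + K * vu i - r i := fun i => by
        have := Int.floor_add_fract (w i)
        simp only [w, r, Pi.add_apply, Pi.smul_apply, smul_eq_mul] at this ⊢
        linarith
      ext i
      simp only [Pi.add_apply, Pi.smul_apply, smul_eq_mul, Pi.neg_apply, hfl]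
      fin_cases i
      · simp only [Fin.zero_eta]; field_simp; rw [hdet]; ring
      · simp only [Fin.mk_one]; field_simp; rw [hdet]; ring
    change _ ∈ E
    rw [this]
    exact hE.add_mem hx ⟨fun i => ⌊w i⌋, rfl⟩
  · linarith [abs_nonneg (vs 0), abs_nonneg (vs 1)]
  · simp only [Pi.neg_apply, abs_neg]
    linarith [abs_nonneg (vu 0), abs_nonneg (vu 1)]

/-- Two points of an invariant finite subset of the torus on a common stable or unstable leaf
coincide. -/
lemma eq_of_mem_leaf {A : Matrix (Fin 2) (Fin 2) ℤ} (hdet : A.det = 1) {lam : ℝ}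
    (hlam : 1 < lam) {vs vu : V} (hd : vs 0 * vu 1 - vs 1 * vu 0 ≠ 0)
    (hAs : actR A vs = lam⁻¹ • vs) (hAu : actR A vu = lam • vu) {Z : Set V}
    (hf : IsTorusFinite Z) (hi : IsInvariant A Z) (x : V) {p q : ℝ × ℝ}
    (hp : p ∈ coords vs vu x Z) (hq : q ∈ coords vs vu x Z) (h : p.1 = q.1 ∨ p.2 = q.2) :
    p = q := by
  have hbox := hf.sub_self.boxFinite_coords hd 0
  have h0 : (actR A)^[1] 0 - 0 ∈ lattice :=
    ⟨0, by simp only [Function.iterate_one, actR, Matrix.mulVec_zero]; ext; simp⟩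
  have hinv := hypInvariant_coords hdet hAs hAu h0 hf.sub_self hi.sub_self
  rw [pow_one] at hinv
  have hmem : (p.1 - q.1, p.2 - q.2) ∈ coords vs vu 0 (Z - Z) :=
    ⟨_, hp, _, hq, by simp only; module⟩
  rcases h with h | h
  · rw [h, _root_.sub_self] at hmem
    exact Prod.ext h (sub_eq_zero.1 (snd_eq_zero_of_fst_eq_zero hlam hbox hinv hmem))
  · rw [h, _root_.sub_self] at hmem
    exact Prod.ext (sub_eq_zero.1 (fst_eq_zero_of_snd_eq_zero hlam hbox hinv hmem)) h

lemma Rect.eq_of_eq {R R' : Rect} (hp : R.p = R'.p) (hs : R.s = R'.s) (hu : R.u = R'.u) :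
    R = R' := by
  cases R; cases R'; simp_all

lemma Rect.mem_carrier_iff {vs vu : V} (hd : vs 0 * vu 1 - vs 1 * vu 0 ≠ 0) (R : Rect)
    (a b : ℝ) : R.p + a • vs + b • vu ∈ R.carrier vs vu ↔
      0 ≤ a ∧ a ≤ R.s ∧ 0 ≤ b ∧ b ≤ R.u := by
  refine ⟨?_, fun ⟨h1, h2, h3, h4⟩ => ⟨a, b, h1, h2, h3, h4, rfl⟩⟩
  rintro ⟨a', b', h1, h2, h3, h4, e⟩
  obtain ⟨rfl, rfl⟩ := Prod.ext_iff.1 (frame_injective hd R.p (a₁ := (a, b)) (a₂ := (a', b')) e)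
  exact ⟨h1, h2, h3, h4⟩

lemma Rect.IsPrimPos.eq_or_eq {vs vu : V} (hd : vs 0 * vu 1 - vs 1 * vu 0 ≠ 0) {X : Set V}
    {R : Rect} (hR : R.IsPrimPos vs vu X) {q : ℝ × ℝ} (hq : q ∈ coords vs vu R.p X)
    (h1 : 0 ≤ q.1) (h2 : q.1 ≤ R.s) (h3 : 0 ≤ q.2) (h4 : q.2 ≤ R.u) :
    q = (0, 0) ∨ q = (R.s, R.u) := by
  have hmem : R.p + q.1 • vs + q.2 • vu ∈ R.carrier vs vu ∩ X :=
    ⟨(R.mem_carrier_iff hd _ _).2 ⟨h1, h2, h3, h4⟩, hq⟩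
  rw [hR.2] at hmem
  rcases hmem with e | e
  · exact Or.inl (frame_injective hd R.p (by simpa using e))
  · exact Or.inr (frame_injective hd R.p e)

lemma Rect.isPrimPos_of_isLowest {vs vu : V} {X : Set V} {R : Rect} (hp : R.p ∈ X)
    (hleaf : ∀ p ∈ coords vs vu R.p X, ∀ q ∈ coords vs vu R.p X,
      p.1 = q.1 ∨ p.2 = q.2 → p = q) {t : ℝ}
    (h : IsLowest (coords vs vu R.p X) t (R.s, R.u)) : R.IsPrimPos vs vu X := by
  refine ⟨⟨hp, h.mem⟩, Subset.antisymm ?_ ?_⟩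
  · rintro _ ⟨⟨a, b, ha0, has, hb0, hbu, rfl⟩, hX⟩
    have h00 : ((0 : ℝ), (0 : ℝ)) ∈ coords vs vu R.p X := by simpa [coords] using hp
    rcases ha0.eq_or_lt with rfl | ha
    · obtain ⟨-, rfl⟩ := Prod.ext_iff.1 (hleaf (0, 0) h00 (0, b) hX (Or.inl rfl))
      simp
    rcases hb0.eq_or_lt with rfl | hb
    · obtain ⟨rfl, -⟩ := Prod.ext_iff.1 (hleaf (0, 0) h00 (a, 0) hX (Or.inr rfl))
      simp
    have hle := h.le (a, b) hX ha (has.trans h.fst_le) hb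
    obtain ⟨rfl, rfl⟩ := Prod.ext_iff.1
      (hleaf (a, b) hX _ h.mem (Or.inr (le_antisymm hbu hle)))
    exact Or.inr rfl
  · rintro _ (rfl | rfl)
    · exact ⟨⟨0, 0, le_rfl, R.s_pos.le, le_rfl, R.u_pos.le, by simp⟩, hp⟩
    · exact ⟨⟨R.s, R.u, R.s_pos.le, le_rfl, R.u_pos.le, le_rfl, rfl⟩, h.mem⟩

/-- the functions `μ(t)` (largest base length `≤ t` of a primitive
positive `(𝒳,x)`-rectangle, realized by a unique rectangle `R(t)`) and `δ(t)`
(smalllest stable coordinate of a point of `𝒴̃` in `R(t)`), with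
`0 < δ(t) < μ(t)`, and the stabilization `μ(δ(t) + λ^{-n}(t - δ(t))) = μ(δ(t))`
for all `n ≥ N`. -/
theorem statement_10 (A : Matrix (Fin 2) (Fin 2) ℤ) (hdet : A.det = 1) (htr : 2 < A.trace)
    (lam : ℝ) (hlam : 1 < lam) (vs vu : V) (hvs : vs ≠ 0) (hvu : vu ≠ 0)
    (hAs : actR A vs = lam⁻¹ • vs) (hAu : actR A vu = lam • vu)
    (X Y : Set V) (hXY : Disjoint X Y) (hXne : X.Nonempty) (hYne : Y.Nonempty)
    (hXfin : IsTorusFinite X) (hXinv : IsInvariant A X)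
    (hYfin : IsTorusFinite Y) (hYinv : IsInvariant A Y)
    (hmeet : ∀ R : Rect, R.IsPos vs vu X → (R.carrier vs vu ∩ Y).Nonempty)
    (x : V) (hx : x ∈ X) :
    ∃ μ : ℝ → ℝ, ∃ Rt : ℝ → Rect,
      (∀ t : ℝ, 0 < t →
        μ t ∈ baseLengths vs vu X x ∩ Set.Ioc 0 t ∧
        (∀ y ∈ baseLengths vs vu X x ∩ Set.Ioc 0 t, y ≤ μ t) ∧
        ((Rt t).IsPrimPos vs vu X ∧ (Rt t).p = x ∧ (Rt t).s = μ t) ∧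
        (∀ R' : Rect, R'.IsPrimPos vs vu X → R'.p = x → R'.s = μ t → R' = Rt t)) ∧
      ∃ δ : ℝ → ℝ,
        (∀ t : ℝ, 0 < t →
          0 < δ t ∧ δ t < μ t ∧
          (∃ b : ℝ, x + δ t • vs + b • vu ∈ Y ∩ (Rt t).carrier vs vu) ∧
          (∀ a : ℝ, 0 < a → (∃ b : ℝ, x + a • vs + b • vu ∈ Y ∩ (Rt t).carrier vs vu) →
            δ t ≤ a)) ∧
        ∃ N : ℕ, ∀ t : ℝ, 0 < t → ∀ n : ℕ, N ≤ n →
          μ (δ t + lam ^ (-(n : ℤ)) * (t - δ t)) = μ (δ t) := by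
  have hd := frame_det_ne_zero hlam hvs hvu hAs hAu
  set D := coords vs vu x X with hDdef
  set E := coords vs vu x Y with hEdef
  have hleaf : ∀ {p q}, p ∈ coords vs vu x (X ∪ Y) → q ∈ coords vs vu x (X ∪ Y) →
      p.1 = q.1 ∨ p.2 = q.2 → p = q :=
    eq_of_mem_leaf hdet hlam hd hAs hAu (hXfin.union hYfin) (hXinv.union hYinv) x
  have hDE : ∀ {p q}, p ∈ D → q ∈ E → p.1 ≠ q.1 := fun {p q} hp hq h => by
    have e : p = q := hleaf (Or.inl hp) (Or.inr hq) (Or.inl h)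
    rw [e] at hp
    exact hXY.notMem_of_mem_left hp hq
  have hDleaf : ∀ p ∈ D, ∀ q ∈ D, p.1 = q.1 ∨ p.2 = q.2 → p = q := fun p hp q hq h =>
    hleaf (Or.inl hp) (Or.inl hq) h
  obtain ⟨n, hn, hret⟩ := exists_return hdet hXfin hXinv hx
  have hc : 1 < lam ^ n := one_lt_pow₀ hlam hn.ne'
  have hDf : BoxFinite D := hXfin.boxFinite_coords hd x
  have hEf : BoxFinite E := hYfin.boxFinite_coords hd x
  have hDi : HypInvariant (lam ^ n) D := hypInvariant_coords hdet hAs hAu hret hXfin hXinv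
  have hEi : HypInvariant (lam ^ n) E := hypInvariant_coords hdet hAs hAu hret hYfin hYinv
  have h00 : ((0 : ℝ), (0 : ℝ)) ∈ D := by simpa [hDdef, coords] using hx
  have hRex : ∀ t : ℝ, ∃ R : Rect, R.p = x ∧ (0 < t → IsLowest D t (R.s, R.u)) := by
    intro t
    by_cases ht : 0 < t
    · obtain ⟨m, hm⟩ :=
        exists_isLowest hDf (exists_mem_strip hc hDi (exists_mem_quadrant hd hXfin hx) ht)
      exact ⟨⟨x, m.1, m.2, hm.fst_pos, hm.snd_pos⟩, rfl, fun _ => hm⟩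
    · exact ⟨⟨x, 1, 1, one_pos, one_pos⟩, rfl, fun h => absurd h ht⟩
  choose Rt hRp hRlow using hRex
  have hprim : ∀ t, 0 < t → (Rt t).IsPrimPos vs vu X := fun t ht =>
    Rect.isPrimPos_of_isLowest (by rw [hRp]; exact hx) (by rw [hRp]; exact hDleaf)
      (by rw [hRp]; exact hRlow t ht)
  have hcarrier : ∀ t a b, x + a • vs + b • vu ∈ (Rt t).carrier vs vu ↔
      0 ≤ a ∧ a ≤ (Rt t).s ∧ 0 ≤ b ∧ b ≤ (Rt t).u := fun t a b => by
    have := (Rt t).mem_carrier_iff hd a b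
    rwa [hRp] at this
  have hdex : ∀ t : ℝ, ∃ d, 0 < t → IsLeftmost E ((Rt t).s, (Rt t).u) d := by
    intro t
    by_cases ht : 0 < t
    · obtain ⟨d, hdl⟩ : ∃ d, IsLeftmost E ((Rt t).s, (Rt t).u) d := by
        refine exists_isLeftmost hEf ?_ fun p hp => (hDE (hRlow t ht).mem hp).symm
        obtain ⟨_, ⟨a, b, ha0, ha, hb0, hb, rfl⟩, hY⟩ := hmeet (Rt t) (hprim t ht).1
        rw [hRp] at hY
        exact ⟨(a, b), hY, lt_of_le_of_ne ha0 (hDE h00 (q := (a, b)) hY), ha, hb0, hb⟩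
      exact ⟨d, fun _ => hdl⟩
    · exact ⟨0, fun h => absurd h ht⟩
  choose d hdl using hdex
  refine ⟨fun t => (Rt t).s, Rt, fun t ht => ⟨?_, ?_, ⟨hprim t ht, hRp t, rfl⟩, ?_⟩,
    fun t => (d t).1, fun t ht => ⟨(hdl t ht).fst_pos, (hdl t ht).fst_lt, ?_, ?_⟩, ?_⟩
  · exact ⟨⟨Rt t, hprim t ht, hRp t, rfl⟩, (Rt t).s_pos, (hRlow t ht).fst_le⟩
  · rintro _ ⟨⟨R, hR, rfl, rfl⟩, hs0, hst⟩
    by_contra! hlt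
    have hu := (hRlow t ht).le (R.s, R.u) hR.1.2 hs0 hst R.u_pos
    rcases hR.eq_or_eq hd (hRlow t ht).mem (Rt t).s_pos.le hlt.le (Rt t).u_pos.le hu with e | e
    · exact (Rt t).s_pos.ne' (congrArg Prod.fst e)
    · exact hlt.ne (congrArg Prod.fst e)
  · intro R' hR hp hs
    have hmem : (R'.s, R'.u) ∈ D := by rw [hDdef, ← hp]; exact hR.1.2
    exact Rect.eq_of_eq (hp.trans (hRp t).symm) hs
      (congrArg Prod.snd (hDleaf _ hmem _ (hRlow t ht).mem (Or.inl hs)))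
  · have h := hdl t ht
    exact ⟨(d t).2, h.mem, (hcarrier t _ _).2
      ⟨h.fst_pos.le, h.fst_lt.le, h.snd_nonneg, h.snd_le⟩⟩
  · rintro a ha ⟨b, hY, hmem⟩
    obtain ⟨h1, h2, h3, h4⟩ := (hcarrier t a b).1 hmem
    exact (hdl t ht).le (a, b) hY ha h2 h3 h4
  · obtain ⟨η, hη, hstab⟩ := exists_stabilization hc hDf hEf hDi hEi
      (fun p hp q hq h => hDleaf p hp q hq (Or.inr h)) hRlow hdl
    obtain ⟨N, hN⟩ := exists_pow_lt_of_lt_one hη (inv_lt_one_of_one_lt₀ hlam)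
    have hlam0 : 0 < lam := one_pos.trans hlam
    refine ⟨N, fun t ht k hk => congrArg Prod.fst (hstab t ht _ (by positivity) ?_)⟩
    rw [_root_.zpow_neg, zpow_natCast, ← inv_pow]
    exact (pow_le_pow_of_le_one (inv_pos.2 hlam0).le (inv_le_one_of_one_le₀ hlam.le) hk).trans
      hN.le

end Paper
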